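/- arXiv:1407.0821 — 2 statements merged into one kernel-verified Lean document; each statement's English description precedes it below -/
import Mathlib

section
/- Let α > 0 and let β be an integer with β > α. There is a constant C > 0 such that every β times continuously differentiable function f : (0,∞) → ℂ satisfying the Mihlin condition K := max_{0 ≤ k ≤ β} sup_{t > 0} |t^k f^{(k)}(t)| < ∞ belongs to the Mihlin class M^α with ‖f‖_{M^α} ≤ C K. -/
open MeasureTheory Filter Topology
open scoped ENNReal NNReal

noncomputable section

/-- Iterated difference `Δ_h^M g (x) = ∑_{j=0}^M (-1)^{M-j} (M choose j) g(x + j h)`. -/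
def iterDiff (M : ℕ) (h : ℝ) (g : ℝ → ℂ) (x : ℝ) : ℂ :=
  ∑ j ∈ Finset.range (M + 1), (-1 : ℂ) ^ (M - j) * (M.choose j : ℂ) * g (x + j * h)

/-- The Besov `ℬ^β_{∞,∞}` norm (with difference parameter `M`). -/
def besovII (β : ℝ) (M : ℕ) (g : ℝ → ℂ) : ℝ≥0∞ :=
  (⨆ x : ℝ, (‖g x‖₊ : ℝ≥0∞)) +
    ⨆ (x : ℝ) (h : ℝ) (_ : h ≠ 0),
      ENNReal.ofReal (|h| ^ (-β)) * (‖iterDiff M h g x‖₊ : ℝ≥0∞)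

/-- The Besov `ℬ^α_{∞,1}` norm (with difference parameter `M`). -/
def besovI1 (α : ℝ) (M : ℕ) (g : ℝ → ℂ) : ℝ≥0∞ :=
  (⨆ x : ℝ, (‖g x‖₊ : ℝ≥0∞)) +
    ∫⁻ h in Set.Ioo (-1 : ℝ) 1,
      ENNReal.ofReal (|h| ^ (-α - 1)) * ⨆ x : ℝ, (‖iterDiff M h g x‖₊ : ℝ≥0∞)

/-- The Mihlin class norm `‖f‖_{M^α} = ‖f ∘ exp‖_{ℬ^α_{∞,1}}`. -/
def mihlin (α : ℝ) (M : ℕ) (f : ℝ → ℂ) : ℝ≥0∞ :=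
  besovI1 α M fun s => f (Real.exp s)

/-- A homogeneous dyadic partition of unity on `(0,∞)`. -/
structure DyadicPartition where
  φ : ℝ → ℝ
  smooth : ContDiff ℝ (⊤ : ℕ∞) φ
  mem_Icc : ∀ t, φ t ∈ Set.Icc (0 : ℝ) 1
  suppSub : ∀ t, φ t ≠ 0 → t ∈ Set.Icc (1 / 2 : ℝ) 2
  sum_one : ∀ t : ℝ, 0 < t → HasSum (fun n : ℤ => φ ((2 : ℝ) ^ (-n) * t)) 1

/-- `φ̇_n(t) = φ̇_0(2^{-n} t)`, as a complex-valued function. -/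
def DyadicPartition.fn (P : DyadicPartition) (n : ℤ) : ℝ → ℂ :=
  fun t => (P.φ ((2 : ℝ) ^ (-n) * t) : ℂ)

/-- The `M^α_1` norm `∑_{n∈ℤ} ‖f ⬝ φ̇_n‖_{M^α}`. -/
def mihlinOne (α : ℝ) (M : ℕ) (P : DyadicPartition) (f : ℝ → ℂ) : ℝ≥0∞ :=
  ∑' n : ℤ, mihlin α M fun t => f t * P.fn n t

/-- A bounded `M^α` calculus on a complex Banach space `X`. -/
structure MihlinCalculus (α : ℝ) (M : ℕ) (X : Type*) [NormedAddCommGroup X]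
    [NormedSpace ℂ X] where
  Φ : (ℝ → ℂ) → X →L[ℂ] X
  C : ℝ
  C_pos : 0 < C
  norm_bound : ∀ f, (‖Φ f‖₊ : ℝ≥0∞) ≤ ENNReal.ofReal C * mihlin α M f
  map_add : ∀ f g, mihlin α M f ≠ ⊤ → mihlin α M g ≠ ⊤ →
    Φ (fun t => f t + g t) = Φ f + Φ g
  map_smul : ∀ (c : ℂ) f, mihlin α M f ≠ ⊤ → Φ (fun t => c * f t) = c • Φ f
  map_mul : ∀ f g, mihlin α M f ≠ ⊤ → mihlin α M g ≠ ⊤ →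
    Φ (fun t => f t * g t) = Φ f * Φ g

/-- The Paley–Littlewood convergence property for a dyadic partition. -/
def PaleyLittlewoodProperty {α : ℝ} {M : ℕ} {X : Type*} [NormedAddCommGroup X]
    [NormedSpace ℂ X] (T : MihlinCalculus α M X) (P : DyadicPartition) : Prop :=
  ∀ x : X, Tendsto (fun N : ℕ => ∑ n ∈ Finset.Icc (-(N : ℤ)) (N : ℤ), T.Φ (P.fn n) x)
    atTop (𝓝 x)

theorem iterDiff_eq_fwdDiff_iter (M : ℕ) (h : ℝ) (g : ℝ → ℂ) :
    iterDiff M h g = (fwdDiff h)^[M] g := by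
  ext x
  rw [fwdDiff_iter_eq_sum_shift]
  refine Finset.sum_congr rfl fun j _ => ?_
  simp [zsmul_eq_mul, nsmul_eq_mul]

theorem iterDiff_zero (h : ℝ) (g : ℝ → ℂ) : iterDiff 0 h g = g := by
  simp [iterDiff_eq_fwdDiff_iter]

theorem iterDiff_succ (M : ℕ) (h : ℝ) (g : ℝ → ℂ) (x : ℝ) :
    iterDiff (M + 1) h g x = iterDiff M h g (x + h) - iterDiff M h g x := by
  simp only [iterDiff_eq_fwdDiff_iter, Function.iterate_succ_apply', fwdDiff]

theorem HasDerivAt.iterDiff {g g' : ℝ → ℂ} (hg : ∀ x, HasDerivAt g (g' x) x) (M : ℕ) (h x : ℝ) :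
    HasDerivAt (iterDiff M h g) (_root_.iterDiff M h g' x) x := by
  induction M generalizing x with
  | zero => simpa only [iterDiff_zero] using hg x
  | succ M ih =>
    have hfun : _root_.iterDiff (M + 1) h g =
        fun y => _root_.iterDiff M h g (y + h) - _root_.iterDiff M h g y :=
      funext (iterDiff_succ M h g)
    rw [hfun, iterDiff_succ]
    exact ((ih (x + h)).comp_add_const x h).sub (ih x)

theorem iterDiff_smul_add (M : ℕ) (h : ℝ) (c : ℂ) (u v : ℝ → ℂ) (x : ℝ) :
    iterDiff M h (fun y => c * u y + v y) x = c * iterDiff M h u x + iterDiff M h v x := by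
  simp only [iterDiff, Finset.mul_sum, ← Finset.sum_add_distrib]
  exact Finset.sum_congr rfl fun j _ => by ring

/-- The Euler derivative `s ↦ e^{ks} f^{(k)}(e^s)` of `f` in logarithmic coordinates. -/
def logEuler (f : ℝ → ℂ) (k : ℕ) (s : ℝ) : ℂ :=
  ((Real.exp s ^ k : ℝ) : ℂ) * iteratedDerivWithin k f (Set.Ioi 0) (Real.exp s)

theorem hasDerivAt_logEuler {f : ℝ → ℂ} {β : ℕ} (hf : ContDiffOn ℝ (β : ℕ∞) f (Set.Ioi 0))
    {k : ℕ} (hk : k < β) (s : ℝ) :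
    HasDerivAt (logEuler f k) (k * logEuler f k s + logEuler f (k + 1) s) s := by
  have hpos : Real.exp s ∈ Set.Ioi (0 : ℝ) := Real.exp_pos s
  have hd : HasDerivAt (iteratedDerivWithin k f (Set.Ioi 0))
      (iteratedDerivWithin (k + 1) f (Set.Ioi 0) (Real.exp s)) (Real.exp s) := by
    have hdiff := hf.differentiableOn_iteratedDerivWithin (m := k)
      (by exact_mod_cast hk) (uniqueDiffOn_Ioi 0)
    rw [iteratedDerivWithin_succ]
    exact ((hdiff _ hpos).hasDerivWithinAt).hasDerivAt (Ioi_mem_nhds hpos)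
  have hexp := Real.hasDerivAt_exp s
  have hcomp := hd.scomp s hexp
  have hprod := ((hexp.pow k).ofReal_comp).mul hcomp
  refine hprod.congr_deriv ?_
  simp only [logEuler, Function.comp_apply, Complex.real_smul, Pi.pow_apply]
  rcases k with _ | k
  · simp
  · push_cast
    ring

theorem norm_iterDiff_logEuler_le {f : ℝ → ℂ} {β : ℕ} {K : ℝ}
    (hf : ContDiffOn ℝ (β : ℕ∞) f (Set.Ioi 0))
    (hK : ∀ k ≤ β, ∀ t : ℝ, 0 < t → t ^ k * ‖iteratedDerivWithin k f (Set.Ioi 0) t‖ ≤ K)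
    (h : ℝ) (n k : ℕ) (hnk : k + n ≤ β) (x : ℝ) :
    ‖iterDiff n h (logEuler f k) x‖ ≤ (β + 1) ^ n * K * |h| ^ n := by
  induction n generalizing k x with
  | zero =>
    rw [iterDiff_zero, logEuler, norm_mul, Complex.norm_real, norm_pow, Real.norm_eq_abs,
      Real.abs_exp]
    simpa using hK k (by omega) _ (Real.exp_pos x)
  | succ n ih =>
    have hderiv (y : ℝ) := HasDerivAt.iterDiff (hasDerivAt_logEuler hf (k := k) (by omega)) n h y
    have hbound (y : ℝ) : ‖iterDiff n h
        (fun s => (k : ℂ) * logEuler f k s + logEuler f (k + 1) s) y‖ ≤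
        (β + 1) ^ (n + 1) * K * |h| ^ n := by
      rw [iterDiff_smul_add]
      have h1 := ih k (by omega) y
      have h2 := ih (k + 1) (by omega) y
      have hkβ : (k : ℝ) ≤ β := by exact_mod_cast (by omega : k ≤ β)
      calc _ ≤ (k : ℝ) * ‖iterDiff n h (logEuler f k) y‖ +
            ‖iterDiff n h (logEuler f (k + 1)) y‖ := by
            refine (norm_add_le _ _).trans_eq ?_
            rw [norm_mul, Complex.norm_natCast]
        _ ≤ β * ((β + 1) ^ n * K * |h| ^ n) + (β + 1) ^ n * K * |h| ^ n := by
            gcongr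
        _ = _ := by ring
    rw [iterDiff_succ]
    have hmvt := Convex.norm_image_sub_le_of_norm_hasDerivWithin_le
      (fun y _ => (hderiv y).hasDerivWithinAt) (fun y _ => hbound y) convex_univ
      (Set.mem_univ x) (Set.mem_univ (x + h))
    refine hmvt.trans_eq ?_
    rw [add_sub_cancel_left, Real.norm_eq_abs]
    ring

theorem norm_iterDiff_add_le {g : ℝ → ℂ} {m : ℕ} {h B : ℝ}
    (hg : ∀ x, ‖iterDiff m h g x‖ ≤ B) (n : ℕ) (x : ℝ) :
    ‖iterDiff (m + n) h g x‖ ≤ 2 ^ n * B := by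
  induction n generalizing x with
  | zero => simpa using hg x
  | succ n ih =>
    rw [← add_assoc, iterDiff_succ]
    refine (norm_sub_le _ _).trans ?_
    rw [pow_succ]
    linarith [ih (x + h), ih x]

theorem integrableOn_abs_rpow {r : ℝ} (hr : -1 < r) :
    IntegrableOn (fun h : ℝ => |h| ^ r) (Set.Ioo (-1) 1) := by
  have hpos : IntervalIntegrable (fun h : ℝ => |h| ^ r) volume 0 1 := by
    refine (intervalIntegral.intervalIntegrable_rpow' hr).congr_uIoo fun h hh => ?_
    rw [Set.uIoo_of_le zero_le_one] at hh
    simp only [abs_of_pos hh.1]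
  have hneg : IntervalIntegrable (fun h : ℝ => |h| ^ r) volume (-1) 0 := by
    simpa using (IntervalIntegrable.comp_sub_left hpos 0).symm
  have := (hneg.trans hpos).1
  exact this.mono_set Set.Ioo_subset_Ioc_self

/-- A bound `|Δ_h^M g| ≤ A |h|^m` with `m > α` controls the `ℬ^α_{∞,1}` norm. -/
theorem besovI1_le {α : ℝ} {m M : ℕ} (hm : α < m) {g : ℝ → ℂ} {A B : ℝ} (hA : 0 ≤ A)
    (hB : 0 ≤ B) (hg : ∀ x, ‖g x‖ ≤ B) (hΔ : ∀ h x, ‖iterDiff M h g x‖ ≤ A * |h| ^ m) :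
    besovI1 α M g ≤ ENNReal.ofReal
      (B + A * ∫ h in Set.Ioo (-1 : ℝ) 1, |h| ^ ((m : ℝ) - α - 1)) := by
  have hint := integrableOn_abs_rpow (r := (m : ℝ) - α - 1) (by linarith)
  have hnn : ∀ h : ℝ, 0 ≤ A * |h| ^ ((m : ℝ) - α - 1) := fun h => by positivity
  rw [ENNReal.ofReal_add hB
    (mul_nonneg hA (integral_nonneg fun h => by positivity)), ← integral_const_mul,
    ofReal_integral_eq_lintegral_ofReal (hint.const_mul A) (ae_of_all _ hnn), besovI1]
  refine add_le_add (iSup_le fun x => ?_) (lintegral_mono_ae ?_)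
  · rw [← enorm_eq_nnnorm, ← ofReal_norm]
    exact ENNReal.ofReal_le_ofReal (hg x)
  · filter_upwards [(Measure.ae_ne volume (0 : ℝ)).filter_mono ae_restrict_le] with h hh
    have hpos : 0 < |h| := abs_pos.mpr hh
    have hsup : (⨆ x : ℝ, (‖iterDiff M h g x‖₊ : ℝ≥0∞)) ≤ ENNReal.ofReal (A * |h| ^ m) := by
      refine iSup_le fun x => ?_
      rw [← enorm_eq_nnnorm, ← ofReal_norm]
      exact ENNReal.ofReal_le_ofReal (hΔ h x)
    refine (mul_le_mul_right hsup _).trans_eq ?_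
    rw [← ENNReal.ofReal_mul (by positivity)]
    congr 1
    rw [show (m : ℝ) - α - 1 = (-α - 1) + m by ring, Real.rpow_add hpos, Real.rpow_natCast]
    ring

/-- a function satisfying the classical Mihlin condition of order `β > α`
belongs to the Mihlin class `M^α`, with norm controlled by the Mihlin constant. -/
theorem stmt_2 (α : ℝ) (hα : 0 < α) (β : ℕ) (hβ : α < (β : ℝ)) (M : ℕ) (hM : α < (M : ℝ)) :
    ∃ C : ℝ, 0 < C ∧ ∀ (f : ℝ → ℂ) (K : ℝ),
      ContDiffOn ℝ (β : ℕ∞) f (Set.Ioi 0) →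
      (∀ k ≤ β, ∀ t : ℝ, 0 < t →
        t ^ k * ‖iteratedDerivWithin k f (Set.Ioi 0) t‖ ≤ K) →
      mihlin α M f ≤ ENNReal.ofReal (C * K) := by
  set m := min M β with hmdef
  have hm : α < m := by
    rw [hmdef, Nat.cast_min]
    exact lt_min hM hβ
  set I := ∫ h in Set.Ioo (-1 : ℝ) 1, |h| ^ ((m : ℝ) - α - 1) with hI
  have hI0 : 0 ≤ I := integral_nonneg fun h => by positivity
  refine ⟨1 + 2 ^ (M - m) * (β + 1) ^ m * I, by positivity, fun f K hf hK => ?_⟩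
  have hf0 (s : ℝ) : ‖f (Real.exp s)‖ ≤ K := by
    simpa using hK 0 (Nat.zero_le _) _ (Real.exp_pos s)
  have hK0 : 0 ≤ K := (norm_nonneg _).trans (hf0 0)
  have hg : (fun s => f (Real.exp s)) = logEuler f 0 := by
    ext s
    simp [logEuler]
  have hΔ (h x : ℝ) : ‖iterDiff M h (fun s => f (Real.exp s)) x‖ ≤
      2 ^ (M - m) * ((β + 1) ^ m * K) * |h| ^ m := by
    have hbound := norm_iterDiff_add_le
      (norm_iterDiff_logEuler_le hf hK h m 0 (by omega)) (M - m) x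
    rw [Nat.add_sub_cancel' (min_le_left M β), ← hg] at hbound
    simpa only [mul_assoc] using hbound
  refine (besovI1_le hm (by positivity) hK0 hf0 hΔ).trans_eq ?_
  rw [← hI]
  congr 1
  ring
end
end

section
/- Let α > 0, let X be a complex Banach space, let (φ̇_n)_{n∈ℤ} be a homogeneous dyadic partition of unity, and let Φ be a bounded M^α calculus on X satisfying the Paley–Littlewood convergence property for (φ̇_n). Then there are constants c₁, c₂ > 0 such that for every x ∈ X: c₁ ‖x‖ ≤ sup { ‖ Σ_{n∈F} a_n Φ(φ̇_n) x ‖ : F ⊂ ℤ finite, a_n ∈ ℂ, |a_n| ≤ 1 } ≤ c₂ ‖x‖; in particular the series Σ_{n∈ℤ} Φ(φ̇_n) x converges unconditionally to x in X. -/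
open MeasureTheory Filter Topology
open scoped ENNReal NNReal

noncomputable section

/-- The set of norms of finite sums `‖∑_{n∈F} a_n T_n x‖` over coefficients `|a_n| ≤ 1`. -/
def plSet {X : Type*} [NormedAddCommGroup X] [NormedSpace ℂ X]
    (T : ℤ → X →L[ℂ] X) (x : X) : Set ℝ :=
  {r : ℝ | ∃ (F : Finset ℤ) (a : ℤ → ℂ), (∀ n, ‖a n‖ ≤ 1) ∧
    r = ‖∑ n ∈ F, a n • T n x‖}

theorem iterDiff_eq_fwdDiff_iterate (M : ℕ) (h : ℝ) (g : ℝ → ℂ) (x : ℝ) :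
    iterDiff M h g x = (fwdDiff h)^[M] g x := by
  rw [fwdDiff_iter_eq_sum_shift]
  simp [iterDiff, zsmul_eq_mul]

/-- The `n`-th difference is controlled by the supremum of the `n`-th derivative. -/
theorem norm_fwdDiff_iterate_le (n : ℕ) (h K : ℝ) (g : ℝ → ℂ) (hg : ContDiff ℝ n g)
    (hK : ∀ y, ‖iteratedDeriv n g y‖ ≤ K) (x : ℝ) :
    ‖(fwdDiff h)^[n] g x‖ ≤ K * |h| ^ n := by
  induction n generalizing g K with
  | zero => simpa using hK x
  | succ n ih =>
    have hgn : ContDiff ℝ n g := hg.of_le (by exact_mod_cast n.le_succ)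
    have hshift : ContDiff ℝ n fun y => g (y + h) := hgn.comp (contDiff_id.add contDiff_const)
    rw [Function.iterate_succ_apply, pow_succ', ← mul_assoc]
    refine ih _ _ (hshift.sub hgn) fun y => ?_
    have hsub : iteratedDeriv n (fwdDiff h g) y
        = iteratedDeriv n g (y + h) - iteratedDeriv n g y := by
      change iteratedDeriv n ((fun y => g (y + h)) - g) y = _
      rw [iteratedDeriv_sub hshift.contDiffAt hgn.contDiffAt, iteratedDeriv_comp_add_const]
    have hmvt := Convex.norm_image_sub_le_of_norm_deriv_le (𝕜 := ℝ) (f := iteratedDeriv n g)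
      (s := Set.univ) (C := K) (x := y) (y := y + h)
      (fun z _ => hg.differentiable_iteratedDeriv' n z)
      (fun z _ => by simpa [iteratedDeriv_succ] using hK z) convex_univ trivial trivial
    simpa [hsub] using hmvt

theorem iterDiff_sum {ι : Type*} (M : ℕ) (h : ℝ) (F : Finset ι) (a : ι → ℂ) (g : ι → ℝ → ℂ)
    (x : ℝ) :
    iterDiff M h (fun s => ∑ n ∈ F, a n * g n s) x = ∑ n ∈ F, a n * iterDiff M h (g n) x := by
  simp only [iterDiff, Finset.mul_sum]
  rw [Finset.sum_comm]
  exact Finset.sum_congr rfl fun n _ => Finset.sum_congr rfl fun j _ => by ring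

theorem iterDiff_comp_sub (M : ℕ) (h : ℝ) (g : ℝ → ℂ) (c x : ℝ) :
    iterDiff M h (fun s => g (s - c)) x = iterDiff M h g (x - c) := by
  simp only [iterDiff, add_sub_right_comm]

theorem iterDiff_eq_zero {M : ℕ} {h R : ℝ} {g : ℝ → ℂ} (hg : ∀ y, R < |y| → g y = 0) {x : ℝ}
    (hh : |h| ≤ 1) (hx : R + M < |x|) : iterDiff M h g x = 0 := by
  refine Finset.sum_eq_zero fun j hj => ?_
  rw [hg, mul_zero]
  have hj' : (j : ℝ) ≤ M := by exact_mod_cast Nat.lt_succ_iff.1 (Finset.mem_range.1 hj)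
  have hjh : |(j : ℝ) * h| ≤ M := by
    rw [abs_mul, Nat.abs_cast]
    nlinarith [abs_nonneg h, (j.cast_nonneg : (0 : ℝ) ≤ j)]
  have := abs_sub_abs_le_abs_sub x (-(j * h))
  rw [abs_neg, sub_neg_eq_add] at this
  linarith

/-- Only boundedly many integer translates by multiples of `d` meet a given bounded interval. -/
theorem card_filter_abs_sub_le (F : Finset ℤ) {d : ℝ} (hd : 0 < d) (R x : ℝ) :
    ((F.filter fun n : ℤ => |x - n * d| ≤ R).card : ℝ) ≤ 2 * (⌈R / d⌉₊ + 1) + 1 := by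
  set m : ℤ := ⌊x / d⌋
  set r : ℕ := ⌈R / d⌉₊ + 1
  have hsub : (F.filter fun n : ℤ => |x - n * d| ≤ R) ⊆ Finset.Icc (m - r) (m + r) := by
    intro n hn
    have hn := (Finset.mem_filter.1 hn).2
    have hx : |x / d - n| ≤ R / d := by
      rw [le_div_iff₀ hd, ← abs_of_pos hd, ← abs_mul, abs_of_pos hd, sub_mul,
        div_mul_cancel₀ _ hd.ne']
      exact hn
    have hR := Nat.le_ceil (R / d)
    have h1 := Int.floor_le (x / d)
    have h2 := Int.lt_floor_add_one (x / d)
    obtain ⟨h3, h4⟩ := abs_le.1 hx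
    have hr : (r : ℝ) = ⌈R / d⌉₊ + 1 := by simp [r]
    rw [Finset.mem_Icc]
    constructor
    · have : ((m - r : ℤ) : ℝ) ≤ n := by push_cast; linarith
      exact_mod_cast this
    · have : ((n : ℤ) : ℝ) ≤ ((m + r : ℤ) : ℝ) := by push_cast; linarith
      exact_mod_cast this
  have hcard := Finset.card_le_card hsub
  rw [Int.card_Icc] at hcard
  have : (F.filter fun n : ℤ => |x - n * d| ≤ R).card ≤ 2 * r + 1 := by omega
  calc _ ≤ ((2 * r + 1 : ℕ) : ℝ) := by exact_mod_cast this
    _ = _ := by simp [r]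

theorem lintegral_abs_rpow_lt_top {r : ℝ} (hr : -1 < r) :
    ∫⁻ h in Set.Ioo (-1 : ℝ) 1, ENNReal.ofReal (|h| ^ r) < ⊤ := by
  have h01 : IntervalIntegrable (fun h : ℝ => |h| ^ r) volume (-1) 1 := by
    refine intervalIntegrable_of_even (fun x => by rw [abs_neg]) (fun x hx => ?_)
    refine (intervalIntegral.intervalIntegrable_rpow' (a := 0) (b := x) hr).congr ?_
    intro y hy
    rw [Set.uIoc_of_le hx.le] at hy
    simp [abs_of_pos hy.1]
  have := (intervalIntegrable_iff_integrableOn_Ioo_of_le (by norm_num)).1 h01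
  exact this.lintegral_lt_top

/-- The generator of a dyadic partition in logarithmic coordinates. -/
def DyadicPartition.logFn (P : DyadicPartition) (s : ℝ) : ℂ := (P.φ (Real.exp s) : ℂ)

namespace DyadicPartition

variable (P : DyadicPartition)

theorem fn_exp (n : ℤ) (s : ℝ) : P.fn n (Real.exp s) = P.logFn (s - n * Real.log 2) := by
  have : (2 : ℝ) ^ (-n) = Real.exp (-(n * Real.log 2)) := by
    rw [← Real.rpow_intCast, Real.rpow_def_of_pos two_pos]
    push_cast
    ring_nf
  rw [fn, logFn, this, ← Real.exp_add]
  ring_nf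

theorem logFn_eq_zero {s : ℝ} (hs : Real.log 2 < |s|) : P.logFn s = 0 := by
  by_contra hne
  have hφ : P.φ (Real.exp s) ≠ 0 := fun h => hne (by simp [logFn, h])
  obtain ⟨h1, h2⟩ := P.suppSub _ hφ
  have h3 := (Real.le_log_iff_exp_le two_pos).2 h2
  have h4 := (Real.log_le_iff_le_exp (by norm_num)).2 h1
  rw [one_div, Real.log_inv] at h4
  exact absurd (abs_le.2 ⟨h4, h3⟩) hs.not_ge

theorem hasCompactSupport_logFn : HasCompactSupport P.logFn := by
  refine HasCompactSupport.intro (isCompact_Icc (a := -Real.log 2) (b := Real.log 2)) fun s hs => ?_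
  refine P.logFn_eq_zero (not_le.1 fun h => hs (abs_le.1 h))

theorem contDiff_logFn (n : ℕ) : ContDiff ℝ n P.logFn :=
  (Complex.ofRealCLM.contDiff.comp (P.smooth.comp Real.contDiff_exp)).of_le
    (by exact_mod_cast le_top)

theorem exists_norm_iteratedDeriv_logFn_le (n : ℕ) :
    ∃ K, ∀ s, ‖iteratedDeriv n P.logFn s‖ ≤ K := by
  simp_rw [← norm_iteratedFDeriv_eq_norm_iteratedDeriv]
  exact ((P.contDiff_logFn n).continuous_iteratedFDeriv le_rfl).bounded_above_of_compact_support
    (P.hasCompactSupport_logFn.iteratedFDeriv n)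

theorem norm_sum_fn_le_one (F : Finset ℤ) {a : ℤ → ℂ} (ha : ∀ n, ‖a n‖ ≤ 1) {t : ℝ} (ht : 0 < t) :
    ‖∑ n ∈ F, a n * P.fn n t‖ ≤ 1 := by
  calc ‖∑ n ∈ F, a n * P.fn n t‖ ≤ ∑ n ∈ F, P.φ ((2 : ℝ) ^ (-n) * t) := by
        refine norm_sum_le_of_le _ fun n _ => ?_
        have h0 := (P.mem_Icc ((2 : ℝ) ^ (-n) * t)).1
        rw [norm_mul, fn, Complex.norm_real, Real.norm_of_nonneg h0]
        exact mul_le_of_le_one_left h0 (ha n)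
    _ ≤ 1 := sum_le_hasSum F (fun n _ => (P.mem_Icc _).1) (P.sum_one t ht)

theorem norm_iterDiff_sum_fn_le {M : ℕ} {K : ℝ} (hK : ∀ s, ‖iteratedDeriv M P.logFn s‖ ≤ K)
    (F : Finset ℤ) {a : ℤ → ℂ} (ha : ∀ n, ‖a n‖ ≤ 1) {h : ℝ} (hh : |h| ≤ 1) (x : ℝ) :
    ‖iterDiff M h (fun s => ∑ n ∈ F, a n * P.fn n (Real.exp s)) x‖
      ≤ (2 * (⌈(Real.log 2 + M) / Real.log 2⌉₊ + 1) + 1) * K * |h| ^ M := by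
  have hK0 : 0 ≤ K := (norm_nonneg _).trans (hK 0)
  have hterm : ∀ n ∈ F, ‖a n * iterDiff M h (fun s => P.fn n (Real.exp s)) x‖
      ≤ if |x - n * Real.log 2| ≤ Real.log 2 + M then K * |h| ^ M else 0 := by
    intro n _
    simp_rw [fn_exp]
    rw [iterDiff_comp_sub]
    split_ifs with hn
    · rw [norm_mul, iterDiff_eq_fwdDiff_iterate]
      exact (mul_le_of_le_one_left (norm_nonneg _) (ha n)).trans
        (norm_fwdDiff_iterate_le M h K _ (P.contDiff_logFn M) hK _)
    · rw [iterDiff_eq_zero (fun _ => P.logFn_eq_zero) hh (not_le.1 hn)]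
      simp
  rw [iterDiff_sum]
  refine (norm_sum_le_of_le F hterm).trans ?_
  rw [← Finset.sum_filter, Finset.sum_const, nsmul_eq_mul, mul_assoc]
  exact mul_le_mul_of_nonneg_right (card_filter_abs_sub_le F (Real.log_pos one_lt_two) _ x)
    (by positivity)

/-- Finite sums of the partition with coefficients in the unit disc are bounded in `M^α`. -/
theorem exists_mihlin_sum_fn_le {α : ℝ} {M : ℕ} (hM : α < M) :
    ∃ B : ℝ, 0 < B ∧ ∀ (F : Finset ℤ) (a : ℤ → ℂ), (∀ n, ‖a n‖ ≤ 1) →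
      mihlin α M (fun t => ∑ n ∈ F, a n * P.fn n t) ≤ ENNReal.ofReal B := by
  obtain ⟨K, hK⟩ := P.exists_norm_iteratedDeriv_logFn_le M
  set L : ℝ := (2 * (⌈(Real.log 2 + M) / Real.log 2⌉₊ + 1) + 1) * K
  set I : ℝ≥0∞ := ∫⁻ h in Set.Ioo (-1 : ℝ) 1,
    ENNReal.ofReal (|h| ^ (M - α - 1))
  have hIlt : I < ⊤ := lintegral_abs_rpow_lt_top (by linarith)
  have hfin : 1 + ENNReal.ofReal L * I ≠ ⊤ := by finiteness
  refine ⟨(1 + ENNReal.ofReal L * I).toReal, ENNReal.toReal_pos (by simp) hfin,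
    fun F a ha => ?_⟩
  rw [ENNReal.ofReal_toReal hfin, mihlin, besovI1]
  refine add_le_add (iSup_le fun x => ?_) ?_
  · exact_mod_cast P.norm_sum_fn_le_one F ha (Real.exp_pos x)
  · rw [← lintegral_const_mul' _ _ ENNReal.ofReal_ne_top]
    refine lintegral_mono_ae ?_
    have hne : ∀ᵐ h : ℝ ∂volume.restrict (Set.Ioo (-1 : ℝ) 1), h ≠ 0 :=
      Measure.ae_ne _ _
    filter_upwards [hne, ae_restrict_mem measurableSet_Ioo] with h h0 hh
    have hh1 : |h| ≤ 1 := (abs_lt.2 hh).le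
    have hpos : 0 < |h| := abs_pos.2 h0
    have hsup : ⨆ x : ℝ, (‖iterDiff M h (fun s => ∑ n ∈ F, a n * P.fn n (Real.exp s)) x‖₊ : ℝ≥0∞)
        ≤ ENNReal.ofReal (L * |h| ^ M) := by
      refine iSup_le fun x => ?_
      rw [← enorm_eq_nnnorm, ← ofReal_norm]
      exact ENNReal.ofReal_le_ofReal (P.norm_iterDiff_sum_fn_le hK F ha hh1 x)
    refine (mul_le_mul_right hsup _).trans_eq ?_
    rw [← ENNReal.ofReal_mul (by positivity), ← ENNReal.ofReal_mul' (by positivity)]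
    congr 1
    have : |h| ^ ((M : ℝ) - α - 1) = |h| ^ (-α - 1) * |h| ^ M := by
      rw [← Real.rpow_natCast, ← Real.rpow_add hpos]
      ring_nf
    rw [this]
    ring

theorem fn_ne_zero {n : ℤ} {t : ℝ} (h : P.fn n t ≠ 0) :
    0 < t ∧ (2 : ℝ) ^ (n - 1) ≤ t ∧ t ≤ (2 : ℝ) ^ (n + 1) := by
  have hφ : P.φ ((2 : ℝ) ^ (-n) * t) ≠ 0 := fun h0 => h (by rw [fn, h0, Complex.ofReal_zero])
  obtain ⟨h1, h2⟩ := P.suppSub _ hφ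
  have hp : (0 : ℝ) < 2 ^ n := by positivity
  rw [zpow_neg, inv_mul_eq_div] at h1 h2
  rw [le_div_iff₀ hp] at h1
  rw [div_le_iff₀ hp] at h2
  refine ⟨by linarith, ?_, ?_⟩
  · rw [zpow_sub_one₀ two_ne_zero]
    linarith
  · rw [zpow_add_one₀ two_ne_zero]
    linarith

theorem sum_fn_mul_fn {F : Finset ℤ} {k : ℤ} (hF : Finset.Icc (k - 2) (k + 2) ⊆ F) (t : ℝ) :
    (∑ n ∈ F, P.fn n t) * P.fn k t = P.fn k t := by
  by_cases hk : P.fn k t = 0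
  · simp [hk]
  obtain ⟨ht, hk1, hk2⟩ := P.fn_ne_zero hk
  have hzero : ∀ n ∉ F, P.φ ((2 : ℝ) ^ (-n) * t) = 0 := by
    intro n hn
    by_contra hne
    have hn0 : P.fn n t ≠ 0 := by simpa [fn] using hne
    obtain ⟨-, hn1, hn2⟩ := P.fn_ne_zero hn0
    have h1 := (zpow_le_zpow_iff_right₀ one_lt_two).1 (hn1.trans hk2)
    have h2 := (zpow_le_zpow_iff_right₀ one_lt_two).1 (hk1.trans hn2)
    exact hn (hF (Finset.mem_Icc.2 ⟨by omega, by omega⟩))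
  have hsum := (P.sum_one t ht).unique (hasSum_sum_of_ne_finset_zero hzero)
  have : ∑ n ∈ F, P.fn n t = 1 := by
    simp only [fn]
    rw [← Complex.ofReal_sum, ← hsum, Complex.ofReal_one]
  rw [this, one_mul]

end DyadicPartition

theorem MihlinCalculus.map_zero {α : ℝ} {M : ℕ} {X : Type*} [NormedAddCommGroup X]
    [NormedSpace ℂ X] (T : MihlinCalculus α M X) : T.Φ (fun _ => 0) = 0 := by
  have h0 : mihlin α M (fun _ => 0) = 0 := by simp [mihlin, besovI1, iterDiff]
  have h := T.norm_bound fun _ => 0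
  rw [h0, mul_zero] at h
  simpa using h

theorem MihlinCalculus.map_sum {α : ℝ} {M : ℕ} {X : Type*} [NormedAddCommGroup X]
    [NormedSpace ℂ X] (T : MihlinCalculus α M X) {P : DyadicPartition} (hM : α < M)
    (F : Finset ℤ) {a : ℤ → ℂ} (ha : ∀ n, ‖a n‖ ≤ 1) :
    T.Φ (fun t => ∑ n ∈ F, a n * P.fn n t) = ∑ n ∈ F, a n • T.Φ (P.fn n) := by
  obtain ⟨B, -, hB⟩ := P.exists_mihlin_sum_fn_le hM
  induction F using Finset.induction_on with
  | empty => simpa using T.map_zero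
  | insert n F hn ih =>
    have hsing : ∀ c : ℂ, ‖c‖ ≤ 1 → mihlin α M (fun t => c * P.fn n t) ≠ ⊤ := fun c hc =>
      ne_top_of_le_ne_top ENNReal.ofReal_ne_top (by simpa using hB {n} (fun _ => c) fun _ => hc)
    have hfn : mihlin α M (P.fn n) ≠ ⊤ := by simpa using hsing 1 (by simp)
    simp_rw [Finset.sum_insert hn]
    rw [T.map_add _ _ (hsing _ (ha n)) (ne_top_of_le_ne_top ENNReal.ofReal_ne_top (hB F a ha)),
      T.map_smul _ _ hfn, ih]

theorem MihlinCalculus.exists_norm_sum_le {α : ℝ} {M : ℕ} {X : Type*} [NormedAddCommGroup X]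
    [NormedSpace ℂ X] (T : MihlinCalculus α M X) (P : DyadicPartition) (hM : α < M) :
    ∃ C : ℝ, 0 < C ∧ ∀ (F : Finset ℤ) (a : ℤ → ℂ), (∀ n, ‖a n‖ ≤ 1) →
      ‖∑ n ∈ F, a n • T.Φ (P.fn n)‖ ≤ C := by
  obtain ⟨B, hB0, hB⟩ := P.exists_mihlin_sum_fn_le hM
  refine ⟨T.C * B, mul_pos T.C_pos hB0, fun F a ha => ?_⟩
  rw [← T.map_sum hM F ha]
  have h := (T.norm_bound _).trans (mul_le_mul_right (hB F a ha) (ENNReal.ofReal T.C))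
  rw [← ENNReal.ofReal_mul T.C_pos.le, ← enorm_eq_nnnorm, ← ofReal_norm] at h
  exact (ENNReal.ofReal_le_ofReal_iff (mul_pos T.C_pos hB0).le).1 h

theorem MihlinCalculus.sum_mul_fn {α : ℝ} {M : ℕ} {X : Type*} [NormedAddCommGroup X]
    [NormedSpace ℂ X] (T : MihlinCalculus α M X) {P : DyadicPartition} (hM : α < M)
    {F : Finset ℤ} {k : ℤ} (hF : Finset.Icc (k - 2) (k + 2) ⊆ F) :
    (∑ n ∈ F, T.Φ (P.fn n)) * T.Φ (P.fn k) = T.Φ (P.fn k) := by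
  obtain ⟨B, -, hB⟩ := P.exists_mihlin_sum_fn_le hM
  have hfin : ∀ G : Finset ℤ, mihlin α M (fun t => ∑ n ∈ G, P.fn n t) ≠ ⊤ := fun G =>
    ne_top_of_le_ne_top ENNReal.ofReal_ne_top (by simpa using hB G (fun _ => 1) (by simp))
  have hS : T.Φ (fun t => ∑ n ∈ F, P.fn n t) = ∑ n ∈ F, T.Φ (P.fn n) := by
    simpa using T.map_sum (P := P) hM F (a := fun _ => 1) (by simp)
  rw [← hS, ← T.map_mul _ _ (hfin F) (by simpa using hfin {k})]
  simp_rw [P.sum_fn_mul_fn hF]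

theorem PaleyLittlewoodProperty.hasSum {α : ℝ} {M : ℕ} {X : Type*} [NormedAddCommGroup X]
    [NormedSpace ℂ X] {T : MihlinCalculus α M X} {P : DyadicPartition}
    (hPL : PaleyLittlewoodProperty T P) (hM : α < M) (x : X) :
    HasSum (fun n : ℤ => T.Φ (P.fn n) x) x := by
  obtain ⟨C, hC0, hC⟩ := T.exists_norm_sum_le P hM
  rw [HasSum, SummationFilter.unconditional_filter, Metric.tendsto_atTop]
  intro ε hε
  obtain ⟨N, hN⟩ := Metric.tendsto_atTop.1 (hPL x) (ε / (C + 1)) (by positivity)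
  refine ⟨Finset.Icc (-(N : ℤ) - 2) (N + 2), fun F hF => ?_⟩
  set y : X := ∑ k ∈ Finset.Icc (-(N : ℤ)) N, T.Φ (P.fn k) x with hy
  set S : X →L[ℂ] X := ∑ n ∈ F, T.Φ (P.fn n)
  have hSy : S y = y := by
    rw [hy, _root_.map_sum]
    refine Finset.sum_congr rfl fun k hk => ?_
    have hk := Finset.mem_Icc.1 hk
    exact DFunLike.congr_fun (T.sum_mul_fn hM
      ((Finset.Icc_subset_Icc (by omega) (by omega)).trans hF)) x
  have hS : ‖S‖ ≤ C := by simpa using hC F (fun _ => 1) (by simp)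
  have hyx : ‖y - x‖ < ε / (C + 1) := by simpa [dist_eq_norm] using hN N le_rfl
  have hSx : ∑ n ∈ F, T.Φ (P.fn n) x = S x := by simp [S]
  rw [hSx, dist_eq_norm]
  calc ‖S x - x‖ = ‖(y - x) - S (y - x)‖ := by rw [map_sub, hSy]; congr 1; abel
    _ ≤ ‖y - x‖ + C * ‖y - x‖ :=
        (norm_sub_le _ _).trans (by gcongr; exact S.le_of_opNorm_le hS _)
    _ = (C + 1) * ‖y - x‖ := by ring
    _ < ε := by rwa [lt_div_iff₀' (by positivity)] at hyx

/-- homogeneous Paley–Littlewood decomposition of the norm of `X`. -/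
theorem stmt_7 {X : Type*} [NormedAddCommGroup X] [NormedSpace ℂ X] [CompleteSpace X]
    (α : ℝ) (hα : 0 < α) (M : ℕ) (hM : α < (M : ℝ)) (P : DyadicPartition)
    (T : MihlinCalculus α M X) (hPL : PaleyLittlewoodProperty T P) :
    ∃ c₁ c₂ : ℝ, 0 < c₁ ∧ 0 < c₂ ∧ ∀ x : X,
      (c₁ * ‖x‖ ≤ sSup (plSet (fun n => T.Φ (P.fn n)) x) ∧
        sSup (plSet (fun n => T.Φ (P.fn n)) x) ≤ c₂ * ‖x‖) ∧
      HasSum (fun n : ℤ => T.Φ (P.fn n) x) x := by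
  obtain ⟨C, hC0, hC⟩ := T.exists_norm_sum_le P hM
  refine ⟨1, C, one_pos, hC0, fun x => ⟨?_, hPL.hasSum hM x⟩⟩
  have hub : ∀ r ∈ plSet (fun n => T.Φ (P.fn n)) x, r ≤ C * ‖x‖ := by
    rintro r ⟨F, a, ha, rfl⟩
    simpa using (∑ n ∈ F, a n • T.Φ (P.fn n)).le_of_opNorm_le (hC F a ha) x
  refine ⟨?_, csSup_le ⟨_, ∅, 0, by simp, rfl⟩ hub⟩
  rw [one_mul]
  refine le_of_tendsto (hPL x).norm (Eventually.of_forall fun N => ?_)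
  exact le_csSup ⟨_, hub⟩ ⟨Finset.Icc (-(N : ℤ)) N, fun _ => 1, by simp, by simp⟩

end
end
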